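/- arXiv:1512.07537 — 2 statements merged into one kernel-verified Lean document; each statement's English description precedes it below -/
import Mathlib

section
/- Let y_1, …, y_n ∈ ℝ with weights w_1, …, w_n > 0, let a ∈ ℝ be a left anchor, and let m ∈ {0,…,n} be a split such that max_{i≤m} w_i·|a − y_i| > r({m+1,…,n}). Then some split m' ≤ m is optimal for the left-anchored 2-step problem: LA(a) = min_{0 ≤ m' ≤ m} E(m'). (The first partition of an optimal left-anchored 2-step function is contained in the first m points.) -/
/-- Maximum of a real-valued function over a finite set, with the maximum
over the empty set being `0`. -/
noncomputable def fmax {ι : Type*} (s : Finset ι) (f : ι → ℝ) : ℝ :=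
  if h : s.Nonempty then s.sup' h f else 0

/-- Cost of the left block `{1, …, m}` with the left anchor `a`:
`max_{i ≤ m} w i * |a - y i|` (points are indexed by `Fin n`, point `i`
being the `(i+1)`-st point). -/
noncomputable def leftCost (n : ℕ) (y w : Fin n → ℝ) (a : ℝ) (m : ℕ) : ℝ :=
  fmax (Finset.univ.filter fun i : Fin n => (i : ℕ) < m)
    fun i => w i * |a - y i|

/-- The 1-center radius of the suffix `{m+1, …, n}`:
`inf_t max_{i > m} w i * |t - y i|`. -/
noncomputable def suffixRadius (n : ℕ) (y w : Fin n → ℝ) (m : ℕ) : ℝ :=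
  ⨅ t : ℝ, fmax (Finset.univ.filter fun i : Fin n => m ≤ (i : ℕ))
    fun i => w i * |t - y i|

/-- The left-anchored 2-step cost of the split `m ∈ {0, …, n}`:
`E(m) = max( max_{i ≤ m} w i * |a - y i|, r({m+1, …, n}) )`. -/
noncomputable def laCost (n : ℕ) (y w : Fin n → ℝ) (a : ℝ) (m : ℕ) : ℝ :=
  max (leftCost n y w a m) (suffixRadius n y w m)

/-- The optimal left-anchored 2-step cost `LA(a) = min_{0 ≤ m ≤ n} E(m)`. -/
noncomputable def laOpt (n : ℕ) (y w : Fin n → ℝ) (a : ℝ) : ℝ :=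
  (Finset.range (n + 1)).inf' ⟨0, Finset.mem_range.mpr n.succ_pos⟩
    (laCost n y w a)

theorem fmax_mono {ι : Type*} {s t : Finset ι} {f : ι → ℝ} (hst : s ⊆ t)
    (hf : ∀ i ∈ t, 0 ≤ f i) : fmax s f ≤ fmax t f := by
  unfold fmax
  by_cases hs : s.Nonempty
  · rw [dif_pos hs, dif_pos (hs.mono hst)]
    exact Finset.sup'_mono f hst hs
  · rw [dif_neg hs]
    split_ifs with ht
    · obtain ⟨i, hi⟩ := ht
      exact (hf i hi).trans (Finset.le_sup' f hi)
    · exact le_rfl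

theorem leftCost_mono {n : ℕ} (y : Fin n → ℝ) {w : Fin n → ℝ} (hw : ∀ i, 0 ≤ w i) (a : ℝ) :
    Monotone (leftCost n y w a) := by
  intro m k hmk
  refine fmax_mono ?_ fun i _ => mul_nonneg (hw i) (abs_nonneg _)
  exact Finset.monotone_filter_right _ fun i _ hi => lt_of_lt_of_le hi hmk

/-- If at split `m` the left cost is strictly greater than the 1-center
radius of the suffix, then some split `m' ≤ m` is optimal for the
left-anchored 2-step problem: the first part of an optimal left-anchored
2-step function is contained in the first `m` points. -/
theorem la_optimal_split_le (n : ℕ) (y w : Fin n → ℝ) (hw : ∀ i, 0 < w i)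
    (a : ℝ) (m : ℕ) (hmn : m ≤ n)
    (hgt : suffixRadius n y w m < leftCost n y w a m) :
    laOpt n y w a =
      (Finset.Icc 0 m).inf' ⟨0, Finset.mem_Icc.mpr ⟨Nat.zero_le 0, Nat.zero_le m⟩⟩
        (laCost n y w a) := by
  apply le_antisymm
  · exact Finset.inf'_mono _ (fun k hk => by
      simp only [Finset.mem_Icc, Finset.mem_range] at hk ⊢; omega) _
  · refine Finset.le_inf' _ _ fun k _ => ?_
    rcases le_total k m with hkm | hmk
    · exact Finset.inf'_le _ (Finset.mem_Icc.mpr ⟨k.zero_le, hkm⟩)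
    · calc _ ≤ laCost n y w a m :=
            Finset.inf'_le _ (Finset.mem_Icc.mpr ⟨m.zero_le, le_rfl⟩)
        _ = leftCost n y w a m := max_eq_left hgt.le
        _ ≤ leftCost n y w a k := leftCost_mono y (fun i => (hw i).le) a hmk
        _ ≤ laCost n y w a k := le_max_left _ _
end

section
/- Let n ≥ 1 and k ≥ 1, let y_1, …, y_n ∈ ℝ with weights w_1, …, w_n > 0, and let D* be the optimal k-step cost of {1,…,n}. Let P_1 = {1,…,a_1} be a nonempty prefix of the points and suppose that {1,…,n} is not r(P_1)-feasible with k steps, i.e., r(P_1) < D*. Then there exists an optimal k-step function (of cost D*) whose first part contains P_1. -/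
/-- The `j`-th part of the contiguous partition of points (indexed by
`Fin n`, point `i` being the `(i+1)`-st point) with breakpoints `a`:
the indices `i` with `a (j-1) < i + 1 ≤ a j`. -/
def part (n : ℕ) (a : ℕ → ℕ) (j : ℕ) : Finset (Fin n) :=
  Finset.univ.filter fun i => a (j - 1) ≤ (i : ℕ) ∧ (i : ℕ) < a j

/-- `a` is a breakpoint sequence for a contiguous partition into `steps`
parts of the indices from `lo` to `hi`. -/
def IsBP (steps lo hi : ℕ) (a : ℕ → ℕ) : Prop :=
  a 0 = lo ∧ a steps = hi ∧ ∀ j < steps, a j ≤ a (j + 1)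

/-- The cost of a set `S` of points at height `t`:
`max_{i ∈ S} w i * |t - y i|` (`0` if `S` is empty). -/
noncomputable def setCost (n : ℕ) (y w : Fin n → ℝ) (S : Finset (Fin n))
    (t : ℝ) : ℝ :=
  fmax S fun i => w i * |t - y i|

/-- The 1-center radius of a set `S` of points. -/
noncomputable def radius (n : ℕ) (y w : Fin n → ℝ) (S : Finset (Fin n)) : ℝ :=
  ⨅ t : ℝ, setCost n y w S t

/-- The cost of the step function with breakpoints `a` and heights `h`,
using `steps` steps. -/
noncomputable def stepCost (n steps : ℕ) (y w : Fin n → ℝ) (a : ℕ → ℕ)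
    (h : ℕ → ℝ) : ℝ :=
  fmax (Finset.Icc 1 steps) fun j => setCost n y w (part n a j) (h j)

/-- The optimal `steps`-step cost of the prefix consisting of the first
`hi` points. -/
noncomputable def optCost (n steps hi : ℕ) (y w : Fin n → ℝ) : ℝ :=
  sInf {D | ∃ a h, IsBP steps 0 hi a ∧ stepCost n steps y w a h = D}

theorem le_fmax {ι : Type*} {s : Finset ι} (f : ι → ℝ) {i : ι} (hi : i ∈ s) :
    f i ≤ fmax s f := by
  rw [fmax, dif_pos ⟨i, hi⟩]
  exact Finset.le_sup' f hi

theorem fmax_le {ι : Type*} {s : Finset ι} {f : ι → ℝ} {D : ℝ} (hD : 0 ≤ D)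
    (h : ∀ i ∈ s, f i ≤ D) : fmax s f ≤ D := by
  unfold fmax
  split_ifs with hs
  · exact Finset.sup'_le hs f h
  · exact hD

theorem fmax_nonneg {ι : Type*} {s : Finset ι} {f : ι → ℝ}
    (h : ∀ i ∈ s, 0 ≤ f i) : 0 ≤ fmax s f := by
  by_cases hs : s.Nonempty
  · obtain ⟨i, hi⟩ := hs
    exact (h i hi).trans (le_fmax f hi)
  · rw [fmax, dif_neg hs]

theorem exists_fmax_eq {ι : Type*} {s : Finset ι} (hs : s.Nonempty) (f : ι → ℝ) :
    ∃ i ∈ s, fmax s f = f i := by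
  rw [fmax, dif_pos hs]
  exact Finset.exists_mem_eq_sup' hs f

section Costs

variable {n : ℕ} {y w : Fin n → ℝ}

theorem setCost_nonneg (hw : ∀ i, 0 < w i) (S : Finset (Fin n)) (t : ℝ) :
    0 ≤ setCost n y w S t :=
  fmax_nonneg fun i _ => mul_nonneg (hw i).le (abs_nonneg _)

theorem stepCost_nonneg (hw : ∀ i, 0 < w i) (k : ℕ) (a : ℕ → ℕ) (h : ℕ → ℝ) :
    0 ≤ stepCost n k y w a h :=
  fmax_nonneg fun _ _ => setCost_nonneg hw _ _

theorem setCost_mono (hw : ∀ i, 0 < w i) {S T : Finset (Fin n)} (hST : S ⊆ T) (t : ℝ) :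
    setCost n y w S t ≤ setCost n y w T t :=
  fmax_le (setCost_nonneg hw T t) fun _ hi =>
    le_fmax (fun i => w i * |t - y i|) (hST hi)

theorem setCost_le_stepCost {k j : ℕ} (hj : j ∈ Finset.Icc 1 k) (a : ℕ → ℕ) (h : ℕ → ℝ) :
    setCost n y w (part n a j) (h j) ≤ stepCost n k y w a h :=
  le_fmax (fun j => setCost n y w (part n a j) (h j)) hj

/-- The infimum defining the 1-center radius is attained. -/
theorem exists_setCost_le (hw : ∀ i, 0 < w i) (S : Finset (Fin n)) :
    ∃ t, ∀ s, setCost n y w S t ≤ setCost n y w S s := by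
  by_cases hS : S.Nonempty
  · have hcont : Continuous (setCost n y w S) := by
      have heq : setCost n y w S = fun t => S.sup' hS fun i => w i * |t - y i| := by
        funext t
        rw [setCost, fmax, dif_pos hS]
      rw [heq]
      exact Continuous.finset_sup'_apply hS fun i _ => by fun_prop
    obtain ⟨i, hi⟩ := hS
    refine hcont.exists_forall_le ?_
    refine Filter.tendsto_atTop_mono
      (fun t => le_fmax (fun i => w i * |t - y i|) hi) ?_
    refine Filter.Tendsto.const_mul_atTop (hw i) ?_
    simpa [Real.dist_eq] using tendsto_dist_right_cocompact_atTop (y i)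
  · exact ⟨0, fun s => by simp [setCost, fmax, hS]⟩

theorem optCost_le_stepCost (hw : ∀ i, 0 < w i) {k m : ℕ} {a : ℕ → ℕ} (ha : IsBP k 0 m a)
    (h : ℕ → ℝ) : optCost n k m y w ≤ stepCost n k y w a h := by
  refine csInf_le ⟨0, ?_⟩ ⟨a, h, ha, rfl⟩
  rintro _ ⟨a, h, -, rfl⟩
  exact stepCost_nonneg hw k a h

/-- The infimum defining the optimal `k`-step cost is attained. -/
theorem exists_stepCost_eq_optCost (hw : ∀ i, 0 < w i) {k : ℕ} (hk : 1 ≤ k) (m : ℕ) :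
    ∃ a h, IsBP k 0 m a ∧ stepCost n k y w a h = optCost n k m y w := by
  choose c hc using exists_setCost_le (y := y) hw
  let best : (ℕ → ℕ) → ℝ := fun a => stepCost n k y w a fun j => c (part n a j)
  have hfin : (best '' {a | IsBP k 0 m a}).Finite := by
    refine (Set.finite_range fun S => setCost n y w S (c S)).subset ?_
    rintro _ ⟨a, -, rfl⟩
    obtain ⟨j, -, hj⟩ := exists_fmax_eq (Finset.nonempty_Icc.2 hk)
      fun j => setCost n y w (part n a j) (c (part n a j))
    exact ⟨part n a j, hj.symm⟩
  have hne : {a | IsBP k 0 m a}.Nonempty := by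
    refine ⟨fun j => if j = 0 then 0 else m, rfl, if_neg (by omega), fun j _ => ?_⟩
    by_cases hj : j = 0 <;> simp [hj]
  obtain ⟨_, ⟨a, ha, rfl⟩, hmin⟩ := Set.exists_min_image _ id hfin (hne.image best)
  refine ⟨a, fun j => c (part n a j), ha, le_antisymm ?_ (optCost_le_stepCost hw ha _)⟩
  refine le_csInf ⟨_, a, fun j => c (part n a j), ha, rfl⟩ ?_
  rintro _ ⟨b, h, hb, rfl⟩
  refine (hmin _ ⟨b, hb, rfl⟩).trans ?_
  exact fmax_le (stepCost_nonneg hw k b h) fun j hj =>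
    (hc _ (h j)).trans (setCost_le_stepCost hj b h)

end Costs

/-- If the 1-center radius of the nonempty prefix `P₁ = {1, …, a₁}` is
strictly below the optimal `k`-step cost `D*` of all `n` points (so `{1,…,n}`
is not `r(P₁)`-feasible with `k` steps), then there is an optimal `k`-step
function whose first part contains `P₁`. -/
theorem first_part_contains_prefix (n k : ℕ) (hn : 1 ≤ n) (hk : 1 ≤ k)
    (y w : Fin n → ℝ) (hw : ∀ i, 0 < w i) (a₁ : ℕ) (ha₁ : 1 ≤ a₁)
    (ha₁n : a₁ ≤ n)
    (hr : radius n y w (Finset.univ.filter fun i : Fin n => (i : ℕ) < a₁) <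
      optCost n k n y w) :
    ∃ a h, IsBP k 0 n a ∧ stepCost n k y w a h = optCost n k n y w ∧
      a₁ ≤ a 1 := by
  obtain ⟨a, h, ha, hopt⟩ := exists_stepCost_eq_optCost (y := y) hw hk n
  obtain ⟨t, ht⟩ := exists_lt_of_ciInf_lt hr
  by_cases hle : a₁ ≤ a 1
  · exact ⟨a, h, ha, hopt, hle⟩
  let b : ℕ → ℕ := fun j => if j = 0 then 0 else max (a j) a₁
  let g : ℕ → ℝ := fun j => if j = 1 then t else h j
  have hb : IsBP k 0 n b := by
    obtain ⟨-, hak, hmono⟩ := ha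
    refine ⟨rfl, ?_, fun j hj => ?_⟩
    · simp only [b, if_neg (show k ≠ 0 by omega)]
      omega
    · have := hmono j hj
      by_cases hj0 : j = 0
      · simp [b, hj0]
      · simp only [b, hj0, Nat.succ_ne_zero, if_false]
        omega
  refine ⟨b, g, hb, le_antisymm ?_ (optCost_le_stepCost hw hb g), by simp [b]⟩
  refine fmax_le (hopt ▸ stepCost_nonneg hw k a h) fun j hj => ?_
  by_cases hj1 : j = 1
  · subst hj1
    simp only [g, if_true]
    refine (setCost_mono hw (fun i hi => ?_) t).trans ht.le
    simp only [part, b, Finset.mem_filter, Finset.mem_univ, true_and, one_ne_zero,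
      if_false] at hi ⊢
    omega
  · simp only [g, if_neg hj1]
    rw [← hopt]
    refine (setCost_mono hw (fun i hi => ?_) (h j)).trans (setCost_le_stepCost hj a h)
    have hj2 := (Finset.mem_Icc.1 hj).1
    simp only [part, b, Finset.mem_filter, Finset.mem_univ, true_and,
      if_neg (show j ≠ 0 by omega), if_neg (show j - 1 ≠ 0 by omega)] at hi ⊢
    omega
end
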